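/- Let λ, μ ∈ ℝ with μ > 0 and 3λ + 2μ > 0, and let y ∈ ℝ³₋. For every x = (x₁, x₂, 0) on the boundary plane {x₃ = 0} and each j ∈ {1,2,3}, the column u = N(·,y)e_j of the Neumann function satisfies the traction-free condition (ℂ∇̂_x u)(x) e₃ = 0, i.e. λ (div_x u)(x) e₃ + μ (∇_x u(x) + (∇_x u(x))ᵀ) e₃ = 0. -/

import Mathlib

open MeasureTheory Metric Set

noncomputable section

abbrev E3 := EuclideanSpace ℝ (Fin 3)

/-- Partial derivative of a scalar field in the k-th coordinate direction. -/
def pd (f : E3 → ℝ) (k : Fin 3) (x : E3) : ℝ := fderiv ℝ f x (EuclideanSpace.single k 1)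

/-- Kronecker delta. -/
def kd (i j : Fin 3) : ℝ := if i = j then 1 else 0

/-- Kelvin–Somigliana fundamental matrix `Γ` of the Lamé operator
(with `ν = λ/(2(λ+μ))`, `C_{μ,ν} = 1/(16πμ(1−ν))`). -/
def KelvinG (lam mu : ℝ) (x : E3) : Matrix (Fin 3) (Fin 3) ℝ :=
  let ν := lam / (2 * (lam + mu))
  let Cmn := 1 / (16 * Real.pi * mu * (1 - ν))
  fun i j => -Cmn * ((3 - 4*ν) * kd i j / ‖x‖ + x i * x j / ‖x‖^3)

/-- The matrix `R¹` in the decomposition of the Neumann function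
(with `c_ν = 4(1−ν)(1−2ν)`, `f̃(η) = 1/|η|`, `g̃(η) = 1/(|η| − η₃)`). -/
def Rmat1 (lam mu : ℝ) (η : E3) : Matrix (Fin 3) (Fin 3) ℝ :=
  let ν := lam / (2 * (lam + mu))
  let Cmn := 1 / (16 * Real.pi * mu * (1 - ν))
  let cν := 4 * (1 - ν) * (1 - 2*ν)
  let f := 1 / ‖η‖
  let g := 1 / (‖η‖ - η 2)
  fun i j => Cmn * ( -(f + cν * g) * kd i j - (3 - 4*ν) * η i * η j * f^3
    + cν * (kd i 2 * η j - kd j 2 * (1 - kd i 2) * η i) * f * g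
    + cν * (1 - kd i 2) * (1 - kd j 2) * η i * η j * f * g^2 )

/-- The matrix `R²` in the decomposition of the Neumann function. -/
def Rmat2 (lam mu : ℝ) (η : E3) : Matrix (Fin 3) (Fin 3) ℝ :=
  let ν := lam / (2 * (lam + mu))
  let Cmn := 1 / (16 * Real.pi * mu * (1 - ν))
  let f := 1 / ‖η‖
  fun i j => 2 * Cmn *
    ( (3 - 4*ν) * (kd i 2 * (1 - kd j 2) * η j + kd j 2 * (1 - kd i 2) * η i) * f^3
      - (1 - 2 * kd j 2) * kd i j * η 2 * f^3
      + 3 * (1 - 2 * kd j 2) * η i * η j * η 2 * f^5 )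

/-- The matrix `R³` in the decomposition of the Neumann function. -/
def Rmat3 (lam mu : ℝ) (η : E3) : Matrix (Fin 3) (Fin 3) ℝ :=
  let ν := lam / (2 * (lam + mu))
  let Cmn := 1 / (16 * Real.pi * mu * (1 - ν))
  let f := 1 / ‖η‖
  fun i j => 2 * Cmn * (1 - 2 * kd j 2) * (kd i j * f^3 - 3 * η i * η j * f^5)

/-- Reflection across the boundary plane: `ỹ = (y₁, y₂, −y₃)`. -/
def refl3 (y : E3) : E3 := y - (2 * y 2) • EuclideanSpace.single 2 1

/-- Neumann function of the Lamé operator in the half-space: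
`N(x,y) = Γ(x−y) + R¹(x−ỹ) + y₃ R²(x−ỹ) + y₃² R³(x−ỹ)`. -/
def NeumannN (lam mu : ℝ) (x y : E3) : Matrix (Fin 3) (Fin 3) ℝ :=
  fun i j => KelvinG lam mu (x - y) i j + Rmat1 lam mu (x - refl3 y) i j
    + y 2 * Rmat2 lam mu (x - refl3 y) i j + (y 2)^2 * Rmat3 lam mu (x - refl3 y) i j

def HP (f : E3 → ℝ) (x : E3) (D : Fin 3 → ℝ) : Prop :=
  DifferentiableAt ℝ f x ∧ ∀ k, pd f k x = D k

lemma HP.add {f g : E3 → ℝ} {x : E3} {D E : Fin 3 → ℝ} (hf : HP f x D) (hg : HP g x E) :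
    HP (fun z => f z + g z) x (fun k => D k + E k) := by
  refine ⟨hf.1.add hg.1, fun k => ?_⟩
  simp only [← hf.2 k, ← hg.2 k]
  unfold pd
  rw [fderiv_fun_add hf.1 hg.1]
  rfl

lemma HP.sub {f g : E3 → ℝ} {x : E3} {D E : Fin 3 → ℝ} (hf : HP f x D) (hg : HP g x E) :
    HP (fun z => f z - g z) x (fun k => D k - E k) := by
  refine ⟨hf.1.sub hg.1, fun k => ?_⟩
  simp only [← hf.2 k, ← hg.2 k]
  unfold pd
  rw [fderiv_fun_sub hf.1 hg.1]
  rfl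

lemma HP.mul {f g : E3 → ℝ} {x : E3} {D E : Fin 3 → ℝ} (hf : HP f x D) (hg : HP g x E) :
    HP (fun z => f z * g z) x (fun k => f x * E k + g x * D k) := by
  refine ⟨hf.1.mul hg.1, fun k => ?_⟩
  simp only [← hf.2 k, ← hg.2 k]
  unfold pd
  rw [fderiv_fun_mul hf.1 hg.1]
  simp

lemma HP.neg {f : E3 → ℝ} {x : E3} {D : Fin 3 → ℝ} (hf : HP f x D) :
    HP (fun z => - f z) x (fun k => - D k) := by
  refine ⟨hf.1.neg, fun k => ?_⟩
  simp only [← hf.2 k]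
  unfold pd
  rw [fderiv_fun_neg]
  rfl

lemma HP.const (c : ℝ) (x : E3) : HP (fun _ => c) x (fun _ => 0) := by
  refine ⟨differentiableAt_const c, fun k => ?_⟩
  unfold pd
  simp

lemma HP.pow {f : E3 → ℝ} {x : E3} {D : Fin 3 → ℝ} (hf : HP f x D) (n : ℕ) :
    HP (fun z => f z ^ n) x (fun k => n * f x ^ (n - 1) * D k) := by
  refine ⟨hf.1.pow n, fun k => ?_⟩
  simp only [← hf.2 k]
  unfold pd
  rw [fderiv_fun_pow n hf.1]
  simp

lemma HP.inv {f : E3 → ℝ} {x : E3} {D : Fin 3 → ℝ} (hf : HP f x D) (h : f x ≠ 0) :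
    HP (fun z => 1 / f z) x (fun k => - (1 / f x) ^ 2 * D k) := by
  have h1 : HasFDerivAt (fun z => 1 / f z) (-(f x ^ 2)⁻¹ • fderiv ℝ f x) x := by
    simp only [one_div]
    exact (hasDerivAt_inv h).comp_hasFDerivAt x hf.1.hasFDerivAt
  refine ⟨h1.differentiableAt, fun k => ?_⟩
  simp only [← hf.2 k]
  unfold pd
  rw [h1.fderiv]
  simp

lemma HP.coord (w : E3) (i : Fin 3) (x : E3) : HP (fun z => (z - w) i) x (fun k => kd i k) := by
  have h1 : HasFDerivAt (fun z : E3 => (z - w) i)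
      (EuclideanSpace.proj i : E3 →L[ℝ] ℝ) x := by
    have := ((EuclideanSpace.proj i : E3 →L[ℝ] ℝ).hasFDerivAt (x := x)).sub_const (w i)
    exact this
  refine ⟨h1.differentiableAt, fun k => ?_⟩
  unfold pd
  rw [h1.fderiv]
  simp [kd]

lemma HP.norm (w : E3) (x : E3) (h : x - w ≠ 0) :
    HP (fun z => ‖z - w‖) x (fun k => 1 / ‖x - w‖ * (x - w) k) := by
  have h0 : ‖x - w‖ ≠ 0 := norm_ne_zero_iff.2 h
  have hd : DifferentiableAt ℝ (fun z : E3 => ‖z - w‖) x :=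
    (differentiableAt_id.sub_const w).norm ℝ h
  refine ⟨hd, fun k => ?_⟩
  have h1 : HP (fun z => ‖z - w‖) x (fun k => pd (fun z => ‖z - w‖) k x) := ⟨hd, fun _ => rfl⟩
  have h2 := h1.pow 2
  have h3 : (fun z : E3 => ‖z - w‖ ^ 2)
      = fun z => (z - w) 0 ^ 2 + (z - w) 1 ^ 2 + (z - w) 2 ^ 2 := by
    funext z
    rw [EuclideanSpace.norm_sq_eq, Fin.sum_univ_three]
    simp
  have h4 := (((HP.coord w 0 x).pow 2).add ((HP.coord w 1 x).pow 2)).add ((HP.coord w 2 x).pow 2)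
  rw [← h3] at h4
  have h5 := (h2.2 k).symm.trans (h4.2 k)
  field_simp
  revert h5
  simp only
  generalize pd (fun z : E3 => ‖z - w‖) k x = P
  intro h5
  fin_cases k <;> simp [kd] at h5 ⊢ <;> linarith


lemma HP.congr {f : E3 → ℝ} {x : E3} {D E : Fin 3 → ℝ} (hf : HP f x D) (h : ∀ k, D k = E k) :
    HP f x E := ⟨hf.1, fun k => (hf.2 k).trans (h k)⟩

/-- Explicit formula for the partial derivatives of the Neumann function, divided by `C`. -/
def DN (n h F G : ℝ) (a e : Fin 3 → ℝ) (i j k : Fin 3) : ℝ :=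
  let c := 4 * (1 - n) * (1 - 2 * n)
  let dA := - F^3 * a k
  let dF := - F^3 * e k
  let dG := - G^2 * (F * e k - kd 2 k)
  0 - ((3 - 4*n) * kd i j * dA + (kd i k * a j + a i * kd j k) * F^3 + a i * a j * (3 * F^2 * dA))
  + ( -(dF + c * dG) * kd i j - (3 - 4*n) * ((kd i k * e j + e i * kd j k) * F^3 + e i * e j * (3 * F^2 * dF))
    + c * ((kd i 2 * kd j k - kd j 2 * (1 - kd i 2) * kd i k) * (F * G)
      + (kd i 2 * e j - kd j 2 * (1 - kd i 2) * e i) * (dF * G + F * dG))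
    + c * (1 - kd i 2) * (1 - kd j 2) * ((kd i k * e j + e i * kd j k) * (F * G^2)
      + e i * e j * (dF * G^2 + F * (2 * G * dG))))
  + h * (2 * ((3 - 4*n) * ((kd i 2 * (1 - kd j 2) * kd j k + kd j 2 * (1 - kd i 2) * kd i k) * F^3
      + (kd i 2 * (1 - kd j 2) * e j + kd j 2 * (1 - kd i 2) * e i) * (3 * F^2 * dF))
      - (1 - 2 * kd j 2) * kd i j * (kd 2 k * F^3 + e 2 * (3 * F^2 * dF))
      + 3 * (1 - 2 * kd j 2) * ((kd i k * e j * e 2 + e i * kd j k * e 2 + e i * e j * kd 2 k) * F^5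
        + e i * e j * e 2 * (5 * F^4 * dF))))
  + h^2 * (2 * (1 - 2 * kd j 2) * (kd i j * (3 * F^2 * dF)
      - 3 * ((kd i k * e j + e i * kd j k) * F^5 + e i * e j * (5 * F^4 * dF))))

/-- The algebraic identity behind the traction-free condition. -/
lemma alg_main (n h F G p q : ℝ) (a e : Fin 3 → ℝ) (i j : Fin 3)
    (ha0 : a 0 = p) (ha1 : a 1 = q) (ha2 : a 2 = - h)
    (he0 : e 0 = p) (he1 : e 1 = q) (he2 : e 2 = h)
    (hF : F^2 * (p^2 + q^2 + h^2) = 1) (hG : G * (1 - h * F) = F) :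
    2 * n * (∑ k, DN n h F G a e k j k) * kd i 2
      + (1 - 2 * n) * (DN n h F G a e i j 2 + DN n h F G a e 2 j i) = 0 := by
  rw [Fin.sum_univ_three]
  fin_cases j <;> fin_cases i <;> simp [DN, kd, ha0, ha1, ha2, he0, he1, he2]
  all_goals grind

/-- Traction-free condition on the boundary plane for the columns of the Neumann function:
for `x₃ = 0`, `(ℂ∇̂_x N(·,y)eⱼ)(x) e₃ = 0`, i.e. componentwise
`λ (div u)(x) δ_{i3} + μ (∂u_i/∂x₃ + ∂u₃/∂x_i)(x) = 0` where `u = N(·,y)eⱼ`. -/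
theorem neumann_columns_traction_free (lam mu : ℝ) (hmu : 0 < mu) (hlam : 0 < 3*lam + 2*mu)
    (y : E3) (hy : y 2 < 0) (j : Fin 3) (x : E3) (hx : x 2 = 0) :
    ∀ i : Fin 3,
      lam * (∑ k, pd (fun z => NeumannN lam mu z y k j) k x) * kd i 2
        + mu * (pd (fun z => NeumannN lam mu z y i j) 2 x
            + pd (fun z => NeumannN lam mu z y 2 j) i x) = 0 := by
  have hlm : 0 < lam + mu := by linarith
  have hp0 : x - y ≠ 0 := by
    intro h0
    have h1 : (x - y) 2 = 0 := by rw [h0]; rfl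
    have h2 : (x - y) 2 = x 2 - y 2 := rfl
    linarith
  set w := refl3 y with hw
  have e0 : (x - w) 0 = (x - y) 0 := by simp [hw, refl3]
  have e1 : (x - w) 1 = (x - y) 1 := by simp [hw, refl3]
  have e2 : (x - w) 2 = y 2 := by simp [hw, refl3, hx]; ring
  have e3 : (x - y) 2 = - y 2 := by simp [hx]
  have hq0 : x - w ≠ 0 := by
    intro h0
    have h1 : (x - w) 2 = 0 := by rw [h0]; rfl
    linarith
  have hnn : ‖x - w‖ = ‖x - y‖ := by
    rw [EuclideanSpace.norm_eq, EuclideanSpace.norm_eq, Fin.sum_univ_three, Fin.sum_univ_three,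
      e0, e1, e2, e3]
    simp
  have hq : 0 < ‖x - w‖ := norm_pos_iff.2 hq0
  have hG : ‖x - w‖ - (x - w) 2 ≠ 0 := by rw [e2]; intro h; linarith
  set n := lam / (2 * (lam + mu)) with hn
  set C := 1 / (16 * Real.pi * mu * (1 - n)) with hC
  set F := 1 / ‖x - w‖ with hF
  set G := 1 / (‖x - w‖ - y 2) with hGdef
  have key : ∀ i : Fin 3, HP (fun z => NeumannN lam mu z y i j) x
      (fun k => C * DN n (y 2) F G (x - y) (x - w) i j k) := by
    intro i
    have : (fun z => NeumannN lam mu z y i j) = fun z =>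
        -C * ((3 - 4*n) * kd i j * (1 / ‖z - y‖) + (z - y) i * (z - y) j * (1 / ‖z - y‖)^3)
        + C * ( -(1 / ‖z - w‖ + (4 * (1 - n) * (1 - 2*n)) * (1 / (‖z - w‖ - (z - w) 2))) * kd i j
          - (3 - 4*n) * (z - w) i * (z - w) j * (1 / ‖z - w‖)^3
    + (4 * (1 - n) * (1 - 2*n)) * (kd i 2 * (z - w) j - kd j 2 * (1 - kd i 2) * (z - w) i) * (1 / ‖z - w‖) * (1 / (‖z - w‖ - (z - w) 2))
    + (4 * (1 - n) * (1 - 2*n)) * (1 - kd i 2) * (1 - kd j 2) * (z - w) i * (z - w) j * (1 / ‖z - w‖) * (1 / (‖z - w‖ - (z - w) 2))^2 )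
        + y 2 * (2 * C *
    ( (3 - 4*n) * (kd i 2 * (1 - kd j 2) * (z - w) j + kd j 2 * (1 - kd i 2) * (z - w) i) * (1 / ‖z - w‖)^3
      - (1 - 2 * kd j 2) * kd i j * (z - w) 2 * (1 / ‖z - w‖)^3
      + 3 * (1 - 2 * kd j 2) * (z - w) i * (z - w) j * (z - w) 2 * (1 / ‖z - w‖)^5 ))
        + (y 2)^2 * (2 * C * (1 - 2 * kd j 2) * (kd i j * (1 / ‖z - w‖)^3 - 3 * (z - w) i * (z - w) j * (1 / ‖z - w‖)^5)) := by
        funext z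
        simp only [NeumannN, KelvinG, Rmat1, Rmat2, Rmat3, ← hw, ← hn, ← hC]
        rw [one_div_pow (a := ‖z - y‖)]
        ring
    rw [this]
    apply HP.congr
    focus
      repeat first
        | exact HP.const _ _
        | exact HP.coord _ _ _
        | exact (HP.norm _ _ hp0).inv (norm_ne_zero_iff.2 hp0)
        | exact (HP.norm _ _ hq0).inv (norm_ne_zero_iff.2 hq0)
        | exact ((HP.norm _ _ hq0).sub (HP.coord _ _ _)).inv hG
        | apply HP.pow
        | apply HP.add
        | apply HP.sub
        | apply HP.neg
        | apply HP.mul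
    · intro k
      have e2' : x 2 - w 2 = y 2 := e2
      simp only [PiLp.sub_apply, Pi.sub_apply, e2', ← hF, ← hGdef, ← hnn, DN]
      push_cast
      ring
  have hnn1 : n * (2 * (lam + mu)) = lam := by
    rw [hn]; field_simp
  intro i
  have hA := alg_main n (y 2) F G ((x - y) 0) ((x - y) 1) (x - y) (x - w) i j rfl rfl e3 e0 e1 e2
    (by
      have h1 : ‖x - w‖ ^ 2 = (x - y) 0 ^ 2 + (x - y) 1 ^ 2 + y 2 ^ 2 := by
        rw [EuclideanSpace.norm_sq_eq, Fin.sum_univ_three, e0, e1, e2]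
        simp
      rw [← h1, hF]
      field_simp)
    (by
      have h2 : ‖x - w‖ - y 2 ≠ 0 := by rw [← e2]; exact hG
      rw [hGdef, hF]
      field_simp)
  have hs : (∑ k, pd (fun z => NeumannN lam mu z y k j) k x)
      = C * ∑ k, DN n (y 2) F G (x - y) (x - w) k j k := by
    rw [Finset.mul_sum]
    exact Finset.sum_congr rfl fun k _ => (key k).2 k
  rw [hs, (key i).2 2, (key 2).2 i]
  have hl : lam = 2 * n * (lam + mu) := by linarith
  have hm : mu = (1 - 2 * n) * (lam + mu) := by linarith
  simp only
  generalize (∑ k, DN n (y 2) F G (x - y) (x - w) k j k) = S at *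
  generalize DN n (y 2) F G (x - y) (x - w) i j 2 = S1 at *
  generalize DN n (y 2) F G (x - y) (x - w) 2 j i = S2 at *
  linear_combination (C * (lam + mu)) * hA + (C * S * kd i 2) * hl + (C * (S1 + S2)) * hm

end
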